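/- Let j ∈ {1,2}, ρ_j ≥ 1 and N ∈ ℕ∖{0}. Then there exist positive constants a_{N,ρ_j}, b_{N,ρ_j}, c_{N,ρ_j} such that for all s > 0 and ω > 0: (i) |φ_N^{(j)}(s,ω,ρ_j,1)| ≤ a_{N,ρ_j} ω^{−N/ρ_j}, and (ii) |φ_N^{(j)}(s,ω,ρ_j,1)| ≤ b_{N,ρ_j} ω^{−(1+(N−1)/ρ_j)} s^{1−ρ_j} + c_{N,ρ_j} ω^{−(1+N/ρ_j)} s^{−ρ_j}. One may take a_{N,ρ_j} = Γ(N/ρ_j)/((N−1)! ρ_j); b_{1,ρ_j} = 1/ρ_j and c_{1,ρ_j} = (ρ_j−1)Γ(1/ρ_j)/ρ_j² if N = 1; b_{N,ρ_j} = Γ((N−1)/ρ_j)/(ρ_j²(N−2)!) and c_{N,ρ_j} = (ρ_j−1)Γ(N/ρ_j)/(ρ_j²(N−1)!) if N ≥ 2. -/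

import Mathlib

open MeasureTheory Set

/-- Direction of the ray `Λ^{(j)}(s)`: `e^{(−1)^{j+1} iπ/(2ρ)}`, encoded by the sign `σ`. -/
noncomputable def edir (σ ρ : ℝ) : ℂ := Complex.exp (Complex.I * ((σ * Real.pi / (2 * ρ) : ℝ) : ℂ))

/-- `φ_N^{(j)}(s,ω,ρ,μ) := ((−1)^N/(N−1)!) ∫_{Λ^{(j)}(s)} (z−s)^{N−1} z^{μ−1}
    e^{(−1)^{j+1} iω z^ρ} dz`, the ray `Λ^{(j)}(s) = {s + t e^{(−1)^{j+1} iπ/(2ρ)} : t ≥ 0}`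
    being parametrized by `t`; `σ = (−1)^{j+1}` and complex powers are principal branches. -/
noncomputable def phiN (σ ρ μ : ℝ) (N : ℕ) (s ω : ℝ) : ℂ :=
  ((-1 : ℂ) ^ N / (Nat.factorial (N - 1) : ℂ)) *
    ∫ t in Set.Ioi (0 : ℝ),
      ((t : ℂ) * edir σ ρ) ^ (N - 1) *
        (((s : ℂ) + (t : ℂ) * edir σ ρ) ^ ((μ - 1 : ℝ) : ℂ)) *
        Complex.exp ((σ : ℂ) * Complex.I * (ω : ℂ) * (((s : ℂ) + (t : ℂ) * edir σ ρ) ^ ((ρ : ℝ) : ℂ))) *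
        edir σ ρ

lemma norm_edir (σ ρ : ℝ) : ‖edir σ ρ‖ = 1 := by
  rw [edir, mul_comm, Complex.norm_exp_ofReal_mul_I]

lemma edir_eq (σ ρ : ℝ) :
    edir σ ρ = (Real.cos (σ * Real.pi / (2 * ρ)) : ℝ) +
      (Real.sin (σ * Real.pi / (2 * ρ)) : ℝ) * Complex.I := by
  rw [edir, mul_comm, Complex.exp_mul_I, Complex.ofReal_cos, Complex.ofReal_sin]

lemma edir_re (σ ρ : ℝ) : (edir σ ρ).re = Real.cos (σ * Real.pi / (2 * ρ)) := by
  rw [edir_eq]; simp [-Complex.ofReal_cos, -Complex.ofReal_sin]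

lemma edir_im (σ ρ : ℝ) : (edir σ ρ).im = Real.sin (σ * Real.pi / (2 * ρ)) := by
  rw [edir_eq]; simp [-Complex.ofReal_cos, -Complex.ofReal_sin]

lemma edir_neg_one (ρ : ℝ) : edir (-1) ρ = (starRingEnd ℂ) (edir 1 ρ) := by
  apply Complex.ext
  · rw [Complex.conj_re, edir_re, edir_re, ← Real.cos_neg]
    congr 1; ring
  · rw [Complex.conj_im, edir_im, edir_im, ← Real.sin_neg]
    congr 1; ring

lemma angle_pos {ρ : ℝ} (hρ : 1 ≤ ρ) : 0 < 1 * Real.pi / (2 * ρ) := by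
  have := Real.pi_pos
  positivity

lemma angle_le {ρ : ℝ} (hρ : 1 ≤ ρ) : 1 * Real.pi / (2 * ρ) ≤ Real.pi / 2 := by
  have := Real.pi_pos
  rw [div_le_div_iff₀ (by positivity) (by positivity)]
  nlinarith

lemma edir_re_nonneg {σ ρ : ℝ} (hσ : σ = 1 ∨ σ = -1) (hρ : 1 ≤ ρ) : 0 ≤ (edir σ ρ).re := by
  have h1 : 0 ≤ (edir 1 ρ).re := by
    rw [edir_re]
    exact Real.cos_nonneg_of_neg_pi_div_two_le_of_le
      (by linarith [angle_pos hρ, Real.pi_pos]) (angle_le hρ)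
  rcases hσ with rfl | rfl
  · exact h1
  · rwa [edir_neg_one, Complex.conj_re]

lemma edir_one_im_pos {ρ : ℝ} (hρ : 1 ≤ ρ) : 0 < (edir 1 ρ).im := by
  rw [edir_im]
  exact Real.sin_pos_of_pos_of_lt_pi (angle_pos hρ) (by linarith [angle_le hρ, Real.pi_pos])

lemma ray_re (σ ρ s t : ℝ) : ((s : ℂ) + (t : ℂ) * edir σ ρ).re = s + t * (edir σ ρ).re := by
  simp

lemma ray_im (σ ρ s t : ℝ) : ((s : ℂ) + (t : ℂ) * edir σ ρ).im = t * (edir σ ρ).im := by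
  simp

lemma le_ray_re {σ ρ s t : ℝ} (hσ : σ = 1 ∨ σ = -1) (hρ : 1 ≤ ρ) (ht : 0 ≤ t) :
    s ≤ ((s : ℂ) + (t : ℂ) * edir σ ρ).re := by
  rw [ray_re]
  linarith [mul_nonneg ht (edir_re_nonneg hσ hρ)]

lemma ray_mem_slitPlane {σ ρ s t : ℝ} (hσ : σ = 1 ∨ σ = -1) (hρ : 1 ≤ ρ) (hs : 0 < s)
    (ht : 0 ≤ t) : (s : ℂ) + (t : ℂ) * edir σ ρ ∈ Complex.slitPlane :=
  Or.inl (hs.trans_le (le_ray_re hσ hρ ht))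

lemma arg_ray_mem_Icc {ρ s t : ℝ} (hρ : 1 ≤ ρ) (hs : 0 ≤ s) (ht : 0 < t) :
    ((s : ℂ) + (t : ℂ) * edir 1 ρ).arg ∈ Icc 0 (1 * Real.pi / (2 * ρ)) := by
  set w : ℂ := (s : ℂ) + (t : ℂ) * edir 1 ρ with hw
  set θ := 1 * Real.pi / (2 * ρ) with hθ
  have him : 0 < w.im := by
    rw [hw, ray_im]; exact mul_pos ht (edir_one_im_pos hρ)
  have harg : 0 ≤ w.arg := Complex.arg_nonneg_iff.2 him.le
  refine ⟨harg, ?_⟩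
  by_contra! hlt
  have hsin : 0 < Real.sin (w.arg - θ) :=
    Real.sin_pos_of_pos_of_lt_pi (by linarith) (by linarith [Complex.arg_le_pi w, angle_pos hρ])
  have hnorm : 0 < ‖w‖ := norm_pos_iff.2 fun h => by simp [h] at him
  have key : ‖w‖ * Real.sin (w.arg - θ) = -(s * Real.sin θ) := by
    have h1 := Complex.norm_mul_sin_arg w
    have h2 := Complex.norm_mul_cos_arg w
    have h3 : w.im = t * Real.sin θ := by rw [hw, ray_im, edir_im]
    have h4 : w.re = s + t * Real.cos θ := by rw [hw, ray_re, edir_re]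
    rw [Real.sin_sub]
    linear_combination Real.cos θ * (h1.trans h3) - Real.sin θ * (h2.trans h4)
  have h5 : 0 < Real.sin θ := edir_im 1 ρ ▸ edir_one_im_pos hρ
  nlinarith [mul_pos hnorm hsin, mul_nonneg hs h5.le]

lemma im_cpow_ray_nonneg {ρ s t : ℝ} (hρ : 1 ≤ ρ) (hs : 0 ≤ s) (ht : 0 < t) :
    0 ≤ (((s : ℂ) + (t : ℂ) * edir 1 ρ) ^ ((ρ : ℂ) - 1)).im := by
  obtain ⟨h0, h1⟩ := arg_ray_mem_Icc hρ hs ht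
  set w : ℂ := (s : ℂ) + (t : ℂ) * edir 1 ρ with hw
  have : (ρ : ℂ) - 1 = ((ρ - 1 : ℝ) : ℂ) := by push_cast; rfl
  rw [this, Complex.cpow_ofReal_im]
  refine mul_nonneg (by positivity) (Real.sin_nonneg_of_nonneg_of_le_pi ?_ ?_)
  · exact mul_nonneg h0 (by linarith)
  · have h2 : (1 * Real.pi / (2 * ρ)) * (ρ - 1) ≤ Real.pi := by
      have := Real.pi_pos
      rw [div_mul_eq_mul_div, div_le_iff₀ (by positivity)]
      nlinarith
    exact (mul_le_mul_of_nonneg_right h1 (by linarith)).trans h2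

lemma mul_edir_cpow {ρ t : ℝ} (hρ : 1 ≤ ρ) (ht : 0 < t) :
    ((t : ℂ) * edir 1 ρ) ^ (ρ : ℂ) = ((t ^ ρ : ℝ) : ℂ) * Complex.I := by
  have hlog : Complex.log (edir 1 ρ) = Complex.I * ((1 * Real.pi / (2 * ρ) : ℝ) : ℂ) := by
    rw [edir, Complex.log_exp]
    · rw [Complex.I_mul_im, Complex.ofReal_re]; linarith [angle_pos hρ, Real.pi_pos]
    · rw [Complex.I_mul_im, Complex.ofReal_re]; linarith [angle_le hρ, Real.pi_pos]
  have he : edir 1 ρ ≠ 0 := Complex.exp_ne_zero _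
  have ht' : (t : ℂ) ≠ 0 := by exact_mod_cast ht.ne'
  have hρ0 : (ρ : ℂ) ≠ 0 := by exact_mod_cast (by linarith : ρ ≠ 0)
  rw [Complex.cpow_def_of_ne_zero (mul_ne_zero ht' he), Complex.log_ofReal_mul ht he, hlog,
    add_mul, Complex.exp_add, Real.rpow_def_of_pos ht]
  push_cast
  congr 1
  have : Complex.I * (1 * (Real.pi : ℂ) / (2 * (ρ : ℂ))) * ρ = (Real.pi : ℂ) / 2 * Complex.I := by
    field_simp
  rw [this, Complex.exp_pi_div_two_mul_I]

lemma rpow_le_im_cpow_ray {ρ s t : ℝ} (hρ : 1 ≤ ρ) (hs : 0 ≤ s) (ht : 0 < t) :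
    t ^ ρ ≤ (((s : ℂ) + (t : ℂ) * edir 1 ρ) ^ (ρ : ℂ)).im := by
  have hslit : ∀ x : ℝ, (x : ℂ) + (t : ℂ) * edir 1 ρ ∈ Complex.slitPlane := fun x =>
    Or.inr (by rw [ray_im]; exact (mul_pos ht (edir_one_im_pos hρ)).ne')
  have hder : ∀ x : ℝ, HasDerivAt (fun x : ℝ => (((x : ℂ) + (t : ℂ) * edir 1 ρ) ^ (ρ : ℂ)).im)
      (((ρ : ℂ) * ((x : ℂ) + (t : ℂ) * edir 1 ρ) ^ ((ρ : ℂ) - 1) * 1).im) x := fun x =>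
    Complex.imCLM.hasFDerivAt.comp_hasDerivAt x
      (((hasDerivAt_id (x : ℂ)).add_const _).cpow_const (hslit x)).comp_ofReal
  have hmono := monotoneOn_of_deriv_nonneg (convex_Ici (0 : ℝ))
    (fun x _ => (hder x).continuousAt.continuousWithinAt)
    (fun x _ => (hder x).differentiableAt.differentiableWithinAt)
    (fun x hx => by
      rw [interior_Ici] at hx
      rw [(hder x).deriv, mul_one, Complex.im_ofReal_mul]
      exact mul_nonneg (by linarith) (im_cpow_ray_nonneg hρ (le_of_lt hx) ht))
  have h := hmono (mem_Ici.2 le_rfl) (mem_Ici.2 hs) hs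
  simpa [mul_edir_cpow hρ ht] using h

lemma norm_exp_ray_le {σ ρ s t ω : ℝ} (hσ : σ = 1 ∨ σ = -1) (hρ : 1 ≤ ρ) (hs : 0 < s)
    (hω : 0 < ω) (ht : 0 < t) :
    ‖Complex.exp ((σ : ℂ) * Complex.I * (ω : ℂ) *
      (((s : ℂ) + (t : ℂ) * edir σ ρ) ^ (ρ : ℂ)))‖ ≤ Real.exp (-ω * t ^ ρ) := by
  have him : t ^ ρ ≤ σ * (((s : ℂ) + (t : ℂ) * edir σ ρ) ^ (ρ : ℂ)).im := by
    have h1 := rpow_le_im_cpow_ray hρ hs.le ht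
    rcases hσ with rfl | rfl
    · simpa using h1
    · have hz := Complex.slitPlane_arg_ne_pi (ray_mem_slitPlane (Or.inl rfl) hρ hs ht.le)
      have hc : (s : ℂ) + (t : ℂ) * edir (-1) ρ =
          (starRingEnd ℂ) ((s : ℂ) + (t : ℂ) * edir 1 ρ) := by
        rw [edir_neg_one]; simp
      rw [hc, Complex.conj_cpow _ _ hz, Complex.conj_ofReal, Complex.conj_im]
      linarith
  rw [Complex.norm_exp, Real.exp_le_exp]
  set w := ((s : ℂ) + (t : ℂ) * edir σ ρ) ^ (ρ : ℂ)
  have hre : ((σ : ℂ) * Complex.I * (ω : ℂ) * w).re = -ω * (σ * w.im) := by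
    simp
    ring
  rw [hre]
  nlinarith

/-- `(z - s) ^ n * z ^ α * e ^ (σ i ω z ^ ρ)` at the point `z = s + t * edir σ ρ` of the ray. -/
noncomputable def rayFun (σ ρ s ω : ℝ) (n : ℕ) (α t : ℝ) : ℂ :=
  ((t : ℂ) * edir σ ρ) ^ n * (((s : ℂ) + (t : ℂ) * edir σ ρ) ^ (α : ℂ)) *
    Complex.exp ((σ : ℂ) * Complex.I * (ω : ℂ) * (((s : ℂ) + (t : ℂ) * edir σ ρ) ^ (ρ : ℂ)))

lemma norm_rayFun_le {σ ρ s ω α t : ℝ} (n : ℕ) (hσ : σ = 1 ∨ σ = -1) (hρ : 1 ≤ ρ) (hs : 0 < s)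
    (hω : 0 < ω) (hα : α ≤ 0) (ht : 0 < t) :
    ‖rayFun σ ρ s ω n α t‖ ≤ s ^ α * (t ^ (n : ℝ) * Real.exp (-ω * t ^ ρ)) := by
  have hz : s ≤ ‖(s : ℂ) + (t : ℂ) * edir σ ρ‖ :=
    (le_ray_re hσ hρ ht.le).trans (Complex.re_le_norm _)
  rw [rayFun, norm_mul, norm_mul, norm_pow, norm_mul, norm_edir, Complex.norm_cpow_real,
    Complex.norm_real, Real.norm_of_nonneg ht.le, mul_one, Real.rpow_natCast, ← mul_assoc,
    mul_comm (s ^ α)]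
  have h1 := Real.rpow_le_rpow_of_nonpos hs hz hα
  have h2 := norm_exp_ray_le hσ hρ hs hω ht
  gcongr

lemma hasDerivAt_ray (σ ρ s t : ℝ) :
    HasDerivAt (fun t : ℝ => (s : ℂ) + (t : ℂ) * edir σ ρ) (edir σ ρ) t := by
  simpa using (((hasDerivAt_id (t : ℂ)).mul_const (edir σ ρ)).const_add (s : ℂ)).comp_ofReal

lemma hasDerivAt_cpow_ray {σ ρ s t : ℝ} (hσ : σ = 1 ∨ σ = -1) (hρ : 1 ≤ ρ) (hs : 0 < s)
    (ht : 0 ≤ t) (α : ℂ) :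
    HasDerivAt (fun t : ℝ => ((s : ℂ) + (t : ℂ) * edir σ ρ) ^ α)
      (α * ((s : ℂ) + (t : ℂ) * edir σ ρ) ^ (α - 1) * edir σ ρ) t := by
  have h : HasDerivAt (fun z : ℂ => (s : ℂ) + z * edir σ ρ) (edir σ ρ) (t : ℂ) := by
    simpa using ((hasDerivAt_id (t : ℂ)).mul_const (edir σ ρ)).const_add (s : ℂ)
  exact (h.cpow_const (ray_mem_slitPlane hσ hρ hs ht)).comp_ofReal

lemma hasDerivAt_rayFun {σ ρ s ω t : ℝ} (n : ℕ) (hσ : σ = 1 ∨ σ = -1) (hρ : 1 ≤ ρ) (hs : 0 < s)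
    (ht : 0 ≤ t) (α : ℝ) :
    HasDerivAt (rayFun σ ρ s ω n α)
      (edir σ ρ * (n * rayFun σ ρ s ω (n - 1) α t + α * rayFun σ ρ s ω n (α - 1) t +
        σ * Complex.I * ω * ρ * rayFun σ ρ s ω n (α + ρ - 1) t)) t := by
  have hz : (s : ℂ) + (t : ℂ) * edir σ ρ ≠ 0 :=
    Complex.slitPlane_ne_zero (ray_mem_slitPlane hσ hρ hs ht)
  have h1 : HasDerivAt (fun t : ℝ => (t : ℂ) * edir σ ρ) (edir σ ρ) t := by
    simpa using hasDerivAt_ray σ ρ 0 t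
  have h2 := ((h1.pow n).mul (hasDerivAt_cpow_ray hσ hρ hs ht (α : ℂ))).mul
    ((hasDerivAt_cpow_ray hσ hρ hs ht (ρ : ℂ)).const_mul ((σ : ℂ) * Complex.I * (ω : ℂ))).cexp
  refine h2.congr_deriv ?_
  have h3 : ((s : ℂ) + (t : ℂ) * edir σ ρ) ^ ((α + ρ - 1 : ℝ) : ℂ) =
      ((s : ℂ) + (t : ℂ) * edir σ ρ) ^ (α : ℂ) *
        ((s : ℂ) + (t : ℂ) * edir σ ρ) ^ ((ρ : ℂ) - 1) := by
    rw [← Complex.cpow_add _ _ hz]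
    push_cast
    ring_nf
  have h4 : ((s : ℂ) + (t : ℂ) * edir σ ρ) ^ ((α - 1 : ℝ) : ℂ) =
      ((s : ℂ) + (t : ℂ) * edir σ ρ) ^ ((α : ℂ) - 1) := by push_cast; rfl
  simp only [rayFun, h3, h4, Pi.mul_apply, Pi.pow_apply]
  ring

lemma integrableOn_rayFun {σ ρ s ω α : ℝ} (n : ℕ) (hσ : σ = 1 ∨ σ = -1) (hρ : 1 ≤ ρ)
    (hs : 0 < s) (hω : 0 < ω) (hα : α ≤ 0) :
    IntegrableOn (rayFun σ ρ s ω n α) (Ioi 0) := by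
  have hn : (-1 : ℝ) < n := by linarith [n.cast_nonneg (α := ℝ)]
  refine Integrable.mono' ((integrableOn_rpow_mul_exp_neg_mul_rpow hn
    (by linarith : 0 < ρ) hω).const_mul (s ^ α)) ?_ ?_
  · exact ContinuousOn.aestronglyMeasurable (fun t ht =>
      (hasDerivAt_rayFun n hσ hρ hs (le_of_lt ht) α).continuousAt.continuousWithinAt)
      measurableSet_Ioi
  · exact (ae_restrict_iff' measurableSet_Ioi).2
      (.of_forall fun t ht => norm_rayFun_le n hσ hρ hs hω hα ht)

lemma norm_integral_rayFun_le {σ ρ s ω α : ℝ} (n : ℕ) (hσ : σ = 1 ∨ σ = -1) (hρ : 1 ≤ ρ)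
    (hs : 0 < s) (hω : 0 < ω) (hα : α ≤ 0) :
    ‖∫ t in Ioi (0 : ℝ), rayFun σ ρ s ω n α t‖ ≤
      s ^ α * (ω ^ (-((n : ℝ) + 1) / ρ) * (1 / ρ) * Real.Gamma (((n : ℝ) + 1) / ρ)) := by
  have hn : (-1 : ℝ) < n := by linarith [n.cast_nonneg (α := ℝ)]
  have hρ0 : 0 < ρ := by linarith
  rw [← integral_rpow_mul_exp_neg_mul_rpow hρ0 hn hω, ← integral_const_mul]
  exact norm_integral_le_of_norm_le
    ((integrableOn_rpow_mul_exp_neg_mul_rpow hn hρ0 hω).const_mul (s ^ α))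
    ((ae_restrict_iff' measurableSet_Ioi).2
      (.of_forall fun t ht => norm_rayFun_le n hσ hρ hs hω hα ht))

lemma norm_phiN_one (σ ρ : ℝ) (N : ℕ) (s ω : ℝ) :
    ‖phiN σ ρ 1 N s ω‖ =
      1 / ((N - 1).factorial : ℝ) * ‖∫ t in Ioi (0 : ℝ), rayFun σ ρ s ω (N - 1) 0 t‖ := by
  have h : phiN σ ρ 1 N s ω = ((-1 : ℂ) ^ N / ((N - 1).factorial : ℂ)) *
      ∫ t in Ioi (0 : ℝ), rayFun σ ρ s ω (N - 1) 0 t * edir σ ρ := by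
    simp only [phiN, rayFun, sub_self]
  rw [h, integral_mul_const, norm_mul, norm_mul, norm_edir, mul_one, norm_div, norm_pow, norm_neg,
    norm_one, one_pow, Complex.norm_natCast]

lemma integral_rayFun_by_parts {σ ρ s ω : ℝ} (n : ℕ) (hσ : σ = 1 ∨ σ = -1) (hρ : 1 ≤ ρ)
    (hs : 0 < s) (hω : 0 < ω) :
    edir σ ρ * (n * (∫ t in Ioi (0 : ℝ), rayFun σ ρ s ω (n - 1) (1 - ρ) t) +
      (1 - ρ : ℝ) * (∫ t in Ioi (0 : ℝ), rayFun σ ρ s ω n (-ρ) t) +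
      σ * Complex.I * ω * ρ * ∫ t in Ioi (0 : ℝ), rayFun σ ρ s ω n 0 t) =
    -rayFun σ ρ s ω n (1 - ρ) 0 := by
  have hα : 1 - ρ ≤ 0 := by linarith
  have hd : ∀ t : ℝ, 0 ≤ t → HasDerivAt (rayFun σ ρ s ω n (1 - ρ))
      (edir σ ρ * (n * rayFun σ ρ s ω (n - 1) (1 - ρ) t +
        (1 - ρ : ℝ) * rayFun σ ρ s ω n (-ρ) t +
        σ * Complex.I * ω * ρ * rayFun σ ρ s ω n 0 t)) t := fun t ht => by
    have h := hasDerivAt_rayFun (ω := ω) n hσ hρ hs ht (1 - ρ)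
    rwa [show 1 - ρ - 1 = -ρ by ring, show 1 - ρ + ρ - 1 = 0 by ring] at h
  have i1 := (integrableOn_rayFun (n - 1) hσ hρ hs hω hα).const_mul (n : ℂ)
  have i2 := (integrableOn_rayFun n hσ hρ hs hω (by linarith : -ρ ≤ 0)).const_mul
    ((1 - ρ : ℝ) : ℂ)
  have i3 := (integrableOn_rayFun n hσ hρ hs hω le_rfl).const_mul (σ * Complex.I * ω * ρ : ℂ)
  have hint := ((i1.add i2).add i3).const_mul (edir σ ρ)
  have hlim := tendsto_zero_of_hasDerivAt_of_integrableOn_Ioi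
    (fun t ht => hd t (le_of_lt ht)) hint (integrableOn_rayFun n hσ hρ hs hω hα)
  have h := integral_Ioi_of_hasDerivAt_of_tendsto' (fun t ht => hd t ht) hint hlim
  rw [zero_sub, integral_const_mul, integral_add (by exact i1.add i2) i3, integral_add i1 i2,
    integral_const_mul, integral_const_mul, integral_const_mul] at h
  exact h

lemma norm_rayFun_zero (σ ρ ω : ℝ) {s : ℝ} (n : ℕ) (hs : 0 < s) (α : ℝ) :
    ‖rayFun σ ρ s ω n α 0‖ = if n = 0 then s ^ α else 0 := by
  have h : ‖Complex.exp ((σ : ℂ) * Complex.I * (ω : ℂ) * ((s : ℂ) ^ (ρ : ℂ)))‖ = 1 := by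
    rw [← Complex.ofReal_cpow hs.le, Complex.norm_exp]
    simp
  rcases eq_or_ne n 0 with rfl | hn
  · simp [rayFun, h, Complex.norm_cpow_real, abs_of_pos hs]
  · simp [rayFun, hn]

lemma norm_integral_rayFun_zero_le {σ ρ s ω : ℝ} (n : ℕ) (hσ : σ = 1 ∨ σ = -1) (hρ : 1 ≤ ρ)
    (hs : 0 < s) (hω : 0 < ω) :
    ω * ρ * ‖∫ t in Ioi (0 : ℝ), rayFun σ ρ s ω n 0 t‖ ≤
      (if n = 0 then s ^ (1 - ρ) else 0) +
      n * ‖∫ t in Ioi (0 : ℝ), rayFun σ ρ s ω (n - 1) (1 - ρ) t‖ +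
      (ρ - 1) * ‖∫ t in Ioi (0 : ℝ), rayFun σ ρ s ω n (-ρ) t‖ := by
  have h := integral_rayFun_by_parts n hσ hρ hs hω
  have h0 := norm_rayFun_zero σ ρ ω n hs (1 - ρ)
  set A := ∫ t in Ioi (0 : ℝ), rayFun σ ρ s ω (n - 1) (1 - ρ) t
  set B := ∫ t in Ioi (0 : ℝ), rayFun σ ρ s ω n (-ρ) t
  set C := ∫ t in Ioi (0 : ℝ), rayFun σ ρ s ω n 0 t
  set D := rayFun σ ρ s ω n (1 - ρ) 0
  have hσ' : |σ| = 1 := by rcases hσ with rfl | rfl <;> simp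
  have hC : ‖edir σ ρ * (σ * Complex.I * ω * ρ * C)‖ = ω * ρ * ‖C‖ := by
    simp [norm_edir, hσ', abs_of_pos hω, abs_of_pos (by linarith : 0 < ρ)]
  have hA : ‖edir σ ρ * (n * A)‖ = n * ‖A‖ := by simp [norm_edir]
  have hB : ‖edir σ ρ * ((1 - ρ : ℝ) * B)‖ = (ρ - 1) * ‖B‖ := by
    rw [norm_mul, norm_mul, norm_edir, one_mul, Complex.norm_real,
      Real.norm_of_nonpos (by linarith), neg_sub]
  have heq : edir σ ρ * (σ * Complex.I * ω * ρ * C) =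
      -D - edir σ ρ * (n * A) - edir σ ρ * ((1 - ρ : ℝ) * B) := by
    linear_combination h
  rw [← hC, heq, ← h0, ← hA, ← hB, ← norm_neg D]
  exact (norm_sub_le _ _).trans (add_le_add_left (norm_sub_le _ _) _)

/-- Lemma 1.2: two estimates for `φ_N^{(j)}(s,ω,ρ,1)` (regular amplitude case `μ = 1`),
with the explicit constants `a_{N,ρ}`, `b_{N,ρ}`, `c_{N,ρ}` of the paper. -/
theorem stmt1 (σ ρ : ℝ) (N : ℕ) (hσ : σ = 1 ∨ σ = -1) (hρ : 1 ≤ ρ) (hN : 1 ≤ N) :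
    ∃ a b c : ℝ, 0 < a ∧ 0 < b ∧ 0 ≤ c ∧
      a = Real.Gamma ((N : ℝ) / ρ) / ((Nat.factorial (N - 1) : ℝ) * ρ) ∧
      b = (if N = 1 then 1 / ρ
           else Real.Gamma (((N : ℝ) - 1) / ρ) / (ρ ^ 2 * (Nat.factorial (N - 2) : ℝ))) ∧
      c = (if N = 1 then (ρ - 1) * Real.Gamma (1 / ρ) / ρ ^ 2
           else (ρ - 1) * Real.Gamma ((N : ℝ) / ρ) / (ρ ^ 2 * (Nat.factorial (N - 1) : ℝ))) ∧
      ∀ s : ℝ, 0 < s → ∀ ω : ℝ, 0 < ω →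
        ‖phiN σ ρ 1 N s ω‖ ≤ a * ω ^ (-(N : ℝ) / ρ) ∧
        ‖phiN σ ρ 1 N s ω‖ ≤ b * ω ^ (-(1 + ((N : ℝ) - 1) / ρ)) * s ^ (1 - ρ)
          + c * ω ^ (-(1 + (N : ℝ) / ρ)) * s ^ (-ρ) := by
  obtain ⟨n, rfl⟩ : ∃ n, N = n + 1 := ⟨N - 1, by omega⟩
  have hρ0 : 0 < ρ := by linarith
  have hΓ : ∀ k : ℕ, 0 < Real.Gamma (((k : ℝ) + 1) / ρ) := fun k =>
    Real.Gamma_pos_of_pos (by positivity)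
  refine ⟨_, _, _, ?_, ?_, ?_, rfl, rfl, rfl, fun s hs ω hω => ⟨?_, ?_⟩⟩
  · have := hΓ n
    push_cast
    positivity
  · split_ifs with h
    · positivity
    · obtain ⟨m, rfl⟩ : ∃ m, n = m + 1 := ⟨n - 1, by omega⟩
      have := hΓ m
      push_cast
      rw [add_sub_cancel_right]
      positivity
  · have hρ1 : 0 ≤ ρ - 1 := by linarith
    have h0 := hΓ 0
    have hn := hΓ n
    simp only [Nat.cast_zero, zero_add] at h0
    push_cast
    split_ifs <;> positivity
  · have h := norm_integral_rayFun_le n hσ hρ hs hω le_rfl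
    rw [Real.rpow_zero, one_mul] at h
    rw [norm_phiN_one, Nat.add_sub_cancel]
    push_cast
    refine (mul_le_mul_of_nonneg_left h (by positivity)).trans_eq ?_
    field_simp
  · have h := norm_integral_rayFun_zero_le n hσ hρ hs hω
    have hB := norm_integral_rayFun_le n hσ hρ hs hω (by linarith : -ρ ≤ 0)
    have hB' := mul_le_mul_of_nonneg_left hB (by linarith : 0 ≤ ρ - 1)
    have hpow : ∀ x : ℝ, ω ^ (-(1 + x / ρ)) = ω⁻¹ * ω ^ (-x / ρ) := fun x => by
      rw [neg_add, Real.rpow_add hω, Real.rpow_neg_one, neg_div]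
    rw [norm_phiN_one, Nat.add_sub_cancel, hpow, hpow]
    set X := ‖∫ t in Ioi (0 : ℝ), rayFun σ ρ s ω n 0 t‖
    rcases n with - | m
    · simp only [Nat.cast_zero, zero_mul, add_zero, zero_add, if_true] at h hB'
      have hX : X ≤ (ω * ρ)⁻¹ * (s ^ (1 - ρ) + (ρ - 1) * (s ^ (-ρ) *
          (ω ^ (-1 / ρ) * (1 / ρ) * Real.Gamma (1 / ρ)))) := by
        rw [inv_mul_eq_div, le_div_iff₀ (by positivity)]
        linarith
      simp only [zero_add, Nat.cast_one, if_true, sub_self, neg_zero, zero_div, Real.rpow_zero,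
        Nat.factorial_zero, div_one, one_mul]
      refine hX.trans_eq ?_
      field_simp
    · have hA := norm_integral_rayFun_le m hσ hρ hs hω (by linarith : 1 - ρ ≤ 0)
      have hA' := mul_le_mul_of_nonneg_left hA (by positivity : 0 ≤ ((m + 1 : ℕ) : ℝ))
      rw [if_neg m.succ_ne_zero, Nat.add_sub_cancel, zero_add] at h
      have hX : X ≤ (ω * ρ)⁻¹ * (((m + 1 : ℕ) : ℝ) * (s ^ (1 - ρ) *
          (ω ^ (-((m : ℝ) + 1) / ρ) * (1 / ρ) * Real.Gamma (((m : ℝ) + 1) / ρ))) +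
          (ρ - 1) * (s ^ (-ρ) * (ω ^ (-(((m + 1 : ℕ) : ℝ) + 1) / ρ) * (1 / ρ) *
            Real.Gamma ((((m + 1 : ℕ) : ℝ) + 1) / ρ)))) := by
        rw [inv_mul_eq_div, le_div_iff₀ (by positivity)]
        linarith
      rw [if_neg (by omega), if_neg (by omega), show m + 1 + 1 - 2 = m by omega,
        Nat.factorial_succ]
      refine (mul_le_mul_of_nonneg_left hX (by positivity)).trans_eq ?_
      push_cast
      rw [add_sub_cancel_right]
      field_simp
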